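/- Let 0 < α < γ, x₀ ∈ ℝ^N, r > 0, A > 0 and F ≥ 0. Let f : ℝ^N → ℝ be continuous with |f(x) − f(y)| ≤ F · d(x,y)^α for all x, y, and let g : ℝ^N → ℝ be integrable with |g(x)| ≤ A · r^γ / (r + d(x,x₀))^{N+γ} for all x and ∫_{ℝ^N} g(x) dx = 0. Then the product f·g is integrable and |∫_{ℝ^N} f(x) g(x) dx| ≤ C A F r^α, where C depends only on N, α, γ and the cardinality |G| of G. -/

import Mathlib

open MeasureTheory ENNReal

abbrev Euc (N : ℕ) := EuclideanSpace ℝ (Fin N)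

abbrev OrthG (N : ℕ) := Euc N ≃ₗᵢ[ℝ] Euc N

/-- `d(x,y) := min_{σ ∈ G} ‖x - σ(y)‖`. -/
noncomputable def refDist {N : ℕ} (G : Subgroup (OrthG N)) (x y : Euc N) : ℝ :=
  sInf {r : ℝ | ∃ σ ∈ G, r = ‖x - σ y‖}


lemma refDist_attained {N : ℕ} (G : Subgroup (OrthG N)) [Finite G] (x y : Euc N) :
    ∃ σ : G, refDist G x y = ‖x - (σ : OrthG N) y‖ := by
  have hset : {r : ℝ | ∃ σ ∈ G, r = ‖x - σ y‖} =
      Set.range (fun σ : G => ‖x - (σ : OrthG N) y‖) := by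
    ext r
    simp [eq_comm]
  have hmem : refDist G x y ∈ Set.range (fun σ : G => ‖x - (σ : OrthG N) y‖) := by
    rw [refDist, hset]
    exact (Set.range_nonempty _).csInf_mem (Set.finite_range _)
  obtain ⟨σ, hσ⟩ := hmem
  exact ⟨σ, hσ.symm⟩

lemma refDist_nonneg {N : ℕ} (G : Subgroup (OrthG N)) [Finite G] (x y : Euc N) :
    0 ≤ refDist G x y := by
  obtain ⟨σ, hσ⟩ := refDist_attained G x y
  rw [hσ]
  exact norm_nonneg _

lemma rpow_add_norm_sub_eq {N : ℕ} {r : ℝ} (hr : 0 < r) (s : ℝ) (x y : Euc N) :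
    (r + ‖x - y‖) ^ (-s) = r ^ (-s) * (1 + ‖r⁻¹ • (x - y)‖) ^ (-s) := by
  rw [← Real.mul_rpow hr.le (by positivity), norm_smul, Real.norm_of_nonneg (by positivity)]
  congr 1
  field_simp

lemma integrable_rpow_add_norm_sub {N : ℕ} {r s : ℝ} (hr : 0 < r) (hs : (N : ℝ) < s)
    (y : Euc N) : Integrable (fun x : Euc N => (r + ‖x - y‖) ^ (-s)) := by
  simp_rw [rpow_add_norm_sub_eq hr s _ y]
  have h : Integrable (fun x : Euc N => (1 + ‖x‖) ^ (-s)) :=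
    integrable_one_add_norm (by simpa using hs)
  exact ((h.comp_smul (inv_ne_zero hr.ne')).comp_sub_right y).const_mul _

lemma integral_rpow_add_norm_sub {N : ℕ} {r : ℝ} (hr : 0 < r) (s : ℝ) (y : Euc N) :
    ∫ x : Euc N, (r + ‖x - y‖) ^ (-s) =
      r ^ ((N : ℝ) - s) * ∫ x : Euc N, (1 + ‖x‖) ^ (-s) := by
  simp_rw [rpow_add_norm_sub_eq hr s _ y]
  rw [integral_const_mul,
    integral_sub_right_eq_self (fun x : Euc N => (1 + ‖r⁻¹ • x‖) ^ (-s)) y,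
    Measure.integral_comp_inv_smul_of_nonneg volume (fun x : Euc N => (1 + ‖x‖) ^ (-s)) hr.le,
    finrank_euclideanSpace_fin, smul_eq_mul, ← mul_assoc, ← Real.rpow_natCast,
    ← Real.rpow_add hr]
  congr 2
  ring

lemma rpow_add_refDist_le_sum {N : ℕ} (G : Subgroup (OrthG N)) [Fintype G] {r : ℝ}
    (hr : 0 < r) (s : ℝ) (x y : Euc N) :
    (r + refDist G x y) ^ (-s) ≤ ∑ σ : G, (r + ‖x - (σ : OrthG N) y‖) ^ (-s) := by
  obtain ⟨σ, hσ⟩ := refDist_attained G x y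
  rw [hσ]
  exact Finset.single_le_sum (f := fun σ : G => (r + ‖x - (σ : OrthG N) y‖) ^ (-s))
    (fun _ _ => by positivity) (Finset.mem_univ σ)

/-- pairing of a Hölder function with a smooth molecule. -/
theorem stmt_13 {N : ℕ} (hN : 1 ≤ N) (G : Subgroup (OrthG N)) [Finite G]
    (α γ : ℝ) (hα0 : 0 < α) (hαγ : α < γ) :
    ∃ C : ℝ, 0 < C ∧
      ∀ (x₀ : Euc N) (r A F : ℝ), 0 < r → 0 < A → 0 ≤ F →
      ∀ f : Euc N → ℝ, Continuous f →
        (∀ x y : Euc N, |f x - f y| ≤ F * refDist G x y ^ α) →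
      ∀ g : Euc N → ℝ, Integrable g volume →
        (∀ x : Euc N, |g x| ≤ A * r ^ γ / (r + refDist G x x₀) ^ ((N : ℝ) + γ)) →
        (∫ x : Euc N, g x) = 0 →
        Integrable (fun x => f x * g x) volume ∧
        |∫ x : Euc N, f x * g x| ≤ C * A * F * r ^ α := by
  have : Fintype G := Fintype.ofFinite G
  set s : ℝ := N + γ - α with hs
  set K : ℝ := ∫ x : Euc N, (1 + ‖x‖) ^ (-s) with hK
  have hK0 : 0 ≤ K := integral_nonneg fun x => by positivity
  refine ⟨Fintype.card G * K + 1, by positivity, ?_⟩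
  intro x₀ r A F hr hA hF f hf hfd g hg hgd hg0
  set B : Euc N → ℝ := fun x =>
    F * A * r ^ γ * ∑ σ : G, (r + ‖x - (σ : OrthG N) x₀‖) ^ (-s) with hB
  have hNs : (N : ℝ) < s := by linarith
  have hterm : ∀ σ ∈ (Finset.univ : Finset G),
      Integrable (fun x : Euc N => (r + ‖x - (σ : OrthG N) x₀‖) ^ (-s)) :=
    fun σ _ => integrable_rpow_add_norm_sub hr hNs _
  have hBint : Integrable B := (integrable_finsetSum _ hterm).const_mul _
  have hbound : ∀ x, ‖(f x - f x₀) * g x‖ ≤ B x := fun x => by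
    have hd := refDist_nonneg G x x₀
    have hrd : 0 < r + refDist G x x₀ := by positivity
    calc ‖(f x - f x₀) * g x‖ = |f x - f x₀| * |g x| := by rw [norm_mul]; rfl
      _ ≤ (F * (r + refDist G x x₀) ^ α) *
          (A * r ^ γ / (r + refDist G x x₀) ^ ((N : ℝ) + γ)) := by
        refine mul_le_mul ((hfd x x₀).trans ?_) (hgd x) (abs_nonneg _) (by positivity)
        gcongr
        linarith
      _ = F * A * r ^ γ * (r + refDist G x x₀) ^ (-s) := by
        rw [show -s = α - (N + γ) by rw [hs]; ring, Real.rpow_sub hrd]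
        ring
      _ ≤ B x := by
        simp only [hB]
        gcongr
        exact rpow_add_refDist_le_sum G hr s x x₀
  have hdiff : Integrable (fun x => (f x - f x₀) * g x) :=
    hBint.mono' ((hf.sub continuous_const).aestronglyMeasurable.mul hg.aestronglyMeasurable)
      (.of_forall hbound)
  have hsplit : (fun x => f x * g x) = fun x => (f x - f x₀) * g x + f x₀ * g x := by
    ext x
    ring
  rw [hsplit]
  refine ⟨hdiff.add (hg.const_mul _), ?_⟩
  rw [integral_add hdiff (hg.const_mul _), integral_const_mul, hg0, mul_zero, add_zero]
  calc |∫ x, (f x - f x₀) * g x| ≤ ∫ x, B x :=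
        norm_integral_le_of_norm_le hBint (.of_forall hbound)
    _ = F * A * (Fintype.card G * K) * (r ^ γ * r ^ ((N : ℝ) - s)) := by
        simp only [hB]
        rw [integral_const_mul, integral_finsetSum _ hterm]
        simp_rw [integral_rpow_add_norm_sub hr s]
        rw [Finset.sum_const, Finset.card_univ, nsmul_eq_mul, ← hK]
        ring
    _ = (Fintype.card G * K) * A * F * r ^ α := by
        rw [← Real.rpow_add hr, show γ + ((N : ℝ) - s) = α by rw [hs]; ring]
        ring
    _ ≤ (Fintype.card G * K + 1) * A * F * r ^ α := by
        gcongr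
        linarith
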